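/- For every k ≥ 0, the economic dispatch iterates satisfy the one-step estimate 0 ≤ ⟪x* − x_{k+1}, y_{k+1} − y*⟫ ≤ (1/2)·( V_k − V_{k+1} − ‖y_{k+1} − y_k‖_Ω² − (1/ρ)·‖v_{k+1} − v_k‖² ), where V_k := ‖y_k − y*‖_Ω² + (1/ρ)·‖v_k − v*‖². -/

import Mathlib

open scoped RealInnerProductSpace

section

variable {ι E : Type*} [Fintype ι] [NormedAddCommGroup E] [InnerProductSpace ℝ E]

/-- The standard inner product on tuples `ι → E`, as a bilinear form. -/
noncomputable def tupleInner : (ι → E) →ₗ[ℝ] (ι → E) →ₗ[ℝ] ℝ :=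
  ∑ i, (innerₗ E).compl₁₂ (LinearMap.proj i) (LinearMap.proj i)

theorem tupleInner_apply (u w : ι → E) : tupleInner u w = ∑ i, ⟪u i, w i⟫ := by
  simp [tupleInner]

theorem tupleInner_comm (u w : ι → E) : tupleInner u w = tupleInner w u := by
  simp only [tupleInner_apply, real_inner_comm]

theorem tupleInner_self (u : ι → E) : tupleInner u u = ∑ i, ‖u i‖ ^ 2 := by
  simp only [tupleInner_apply, real_inner_self_eq_norm_sq]

theorem tupleInner_self_eq_zero {u : ι → E} : tupleInner u u = 0 ↔ u = 0 := by
  rw [tupleInner_self, Finset.sum_eq_zero_iff_of_nonneg fun i _ => sq_nonneg _]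
  simp [funext_iff]

/-- A matrix acting blockwise on tuples of vectors. -/
noncomputable def blockMulVec (A : Matrix ι ι ℝ) : (ι → E) →ₗ[ℝ] (ι → E) :=
  LinearMap.pi fun i => ∑ j, A i j • LinearMap.proj j

theorem blockMulVec_apply (A : Matrix ι ι ℝ) (u : ι → E) (i : ι) :
    blockMulVec A u i = ∑ j, A i j • u j := by
  simp [blockMulVec]

theorem blockMulVec_mul (A B : Matrix ι ι ℝ) (u : ι → E) :
    blockMulVec (A * B) u = blockMulVec A (blockMulVec B u) := by
  ext i
  simp only [blockMulVec_apply, Matrix.mul_apply, Finset.sum_smul, Finset.smul_sum, mul_smul]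
  exact Finset.sum_comm

theorem blockMulVec_const {A : Matrix ι ι ℝ} (hA : ∀ i, ∑ j, A i j = 0) (c : E) :
    blockMulVec A (fun _ => c) = 0 := by
  ext i
  simp [blockMulVec_apply, ← Finset.sum_smul, hA]

theorem tupleInner_blockMulVec {A : Matrix ι ι ℝ} (hA : A.IsSymm) (u w : ι → E) :
    tupleInner u (blockMulVec A w) = tupleInner (blockMulVec A u) w := by
  simp only [tupleInner_apply, blockMulVec_apply, inner_sum, sum_inner, real_inner_smul_left,
    real_inner_smul_right]
  rw [Finset.sum_comm]
  simp only [hA.apply]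

theorem blockMulVec_eq_zero_of_mul_self {A : Matrix ι ι ℝ} (hA : A.IsSymm) {u : ι → E}
    (hu : blockMulVec (A * A) u = 0) : blockMulVec A u = 0 := by
  rw [← tupleInner_self_eq_zero, ← tupleInner_blockMulVec hA, ← blockMulVec_mul, hu, map_zero]

/-- Three-point identity for a self-adjoint operator. -/
theorem tupleInner_three_point {T : (ι → E) →ₗ[ℝ] (ι → E)}
    (hT : ∀ u w, tupleInner u (T w) = tupleInner (T u) w) (a b : ι → E) :
    2 * tupleInner b (T (a - b)) =
      tupleInner a (T a) - tupleInner b (T b) - tupleInner (b - a) (T (b - a)) := by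
  have hab : tupleInner a (T b) = tupleInner b (T a) := by rw [hT, tupleInner_comm]
  simp only [map_sub, LinearMap.sub_apply, hab]
  ring

/-- First-order optimality condition for a convex function plus a quadratic penalty. -/
theorem ConvexOn.le_add_inner_of_isMinOn_prox {X : Set E} {f : E → ℝ} (hf : ConvexOn ℝ X f)
    {η : ℝ} (hη : 0 < η) {a x z ξ : E} (hx : x ∈ X) (hξ : ξ ∈ X) (hz : z = η⁻¹ • x + a)
    (hmin : IsMinOn (fun ζ => f ζ + η / 2 * ‖η⁻¹ • ζ + a‖ ^ 2) X x) :
    f x ≤ f ξ + ⟪z, ξ - x⟫ := by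
  set C := η / 2 * ‖η⁻¹ • (ξ - x)‖ ^ 2
  have key : ∀ t ∈ Set.Ioo (0 : ℝ) 1, f x - f ξ - ⟪z, ξ - x⟫ ≤ t * C := by
    rintro t ⟨ht0, ht1⟩
    have hmem := hf.1 hx hξ (sub_nonneg.2 ht1.le) ht0.le (by ring)
    have hconv := hf.2 hx hξ (sub_nonneg.2 ht1.le) ht0.le (by ring)
    have h := isMinOn_iff.1 hmin _ hmem
    have hpt : η⁻¹ • ((1 - t) • x + t • ξ) + a = z + t • (η⁻¹ • (ξ - x)) := by
      rw [hz]; module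
    have hnorm : ‖z + t • (η⁻¹ • (ξ - x))‖ ^ 2 =
        ‖z‖ ^ 2 + 2 * (t * (η⁻¹ * ⟪z, ξ - x⟫)) + t ^ 2 * ‖η⁻¹ • (ξ - x)‖ ^ 2 := by
      rw [norm_add_sq_real, norm_smul, mul_pow, real_inner_smul_right, real_inner_smul_right,
        Real.norm_eq_abs, sq_abs]
    simp only [hpt, hnorm, ← hz] at h
    have hcancel : η / 2 * (2 * (t * (η⁻¹ * ⟪z, ξ - x⟫))) = t * ⟪z, ξ - x⟫ := by
      field_simp
    simp only [smul_eq_mul] at hconv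
    refine le_of_mul_le_mul_left ?_ ht0
    linear_combination h + hconv + hcancel
  have hlim : Filter.Tendsto (fun t : ℝ => t * C) (nhdsWithin 0 (Set.Ioi 0)) (nhds 0) := by
    have : Continuous fun t : ℝ => t * C := by fun_prop
    simpa using (this.tendsto 0).mono_left nhdsWithin_le_nhds
  have := ge_of_tendsto hlim
    (Filter.mem_of_superset (Ioo_mem_nhdsGT one_pos) key)
  linarith

end

/-- CONTEXT: economic dispatch via dual consensus; E = ℝ^p, variables in Eⁿ. -/
theorem stmt_14
    {n p : ℕ} (hn : 1 ≤ n) (hp : 1 ≤ p)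
    (L M : Matrix (Fin n) (Fin n) ℝ)
    (hLsymm : L.IsSymm)
    (hLpsd : ∀ c : Fin n → ℝ, 0 ≤ ∑ i, ∑ j, c i * L i j * c j)
    (hLrow : ∀ i : Fin n, ∑ j, L i j = 0)
    (hMsymm : M.IsSymm)
    (hMpsd : ∀ c : Fin n → ℝ, 0 ≤ ∑ i, ∑ j, c i * M i j * c j)
    (hMM : M * M = L)
    (W S : (Fin n → EuclideanSpace ℝ (Fin p)) → (Fin n → EuclideanSpace ℝ (Fin p)))
    (hW : ∀ (u : Fin n → EuclideanSpace ℝ (Fin p)) (i : Fin n), W u i = ∑ j, L i j • u j)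
    (hS : ∀ (u : Fin n → EuclideanSpace ℝ (Fin p)) (i : Fin n), S u i = ∑ j, M i j • u j)
    {η ρ : ℝ} (hη : 0 < η) (hρ : 0 < ρ)
    (Ω : (Fin n → EuclideanSpace ℝ (Fin p)) → (Fin n → EuclideanSpace ℝ (Fin p)))
    (hΩdef : ∀ u : Fin n → EuclideanSpace ℝ (Fin p), Ω u = η • u - ρ • W u)
    (hΩpd : ∀ u : Fin n → EuclideanSpace ℝ (Fin p), u ≠ 0 → 0 < ∑ i, ⟪u i, Ω u i⟫)
    (X : Fin n → Set (EuclideanSpace ℝ (Fin p)))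
    (hXne : ∀ i, (X i).Nonempty) (hXcl : ∀ i, IsClosed (X i)) (hXconv : ∀ i, Convex ℝ (X i))
    (f : Fin n → EuclideanSpace ℝ (Fin p) → ℝ)
    (hfconv : ∀ i, ConvexOn ℝ Set.univ (f i))
    (d : Fin n → EuclideanSpace ℝ (Fin p))
    (x y v : ℕ → Fin n → EuclideanSpace ℝ (Fin p))
    (hxX : ∀ (k : ℕ) (i : Fin n), x (k+1) i ∈ X i)
    (hstep : ∀ (k : ℕ) (i : Fin n), ∀ ξ ∈ X i,
      f i (x (k+1) i)
          + (η/2) * ‖y k i + η⁻¹ • (x (k+1) i - d i + S (v k) i - ρ • W (y k) i)‖^2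
        ≤ f i ξ + (η/2) * ‖y k i + η⁻¹ • (ξ - d i + S (v k) i - ρ • W (y k) i)‖^2)
    (hy : ∀ k : ℕ, y (k+1) = y k + η⁻¹ • (x (k+1) - d + S (v k) - ρ • W (y k)))
    (hv : ∀ k : ℕ, v (k+1) = v k - ρ • S (y (k+1)))
    (xstar : Fin n → EuclideanSpace ℝ (Fin p)) (δstar : EuclideanSpace ℝ (Fin p))
    (hxstarX : ∀ i, xstar i ∈ X i)
    (hbal : ∑ i, (xstar i - d i) = 0)
    (ystar : Fin n → EuclideanSpace ℝ (Fin p)) (hystar : ystar = fun _ => δstar)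
    (hsaddle : ∀ x' : Fin n → EuclideanSpace ℝ (Fin p), (∀ i, x' i ∈ X i) →
      (∑ i, f i (xstar i)) - ∑ i, ⟪ystar i, x' i - xstar i⟫ ≤ ∑ i, f i (x' i))
    (vstar : Fin n → EuclideanSpace ℝ (Fin p)) (hvstar : S vstar = d - xstar)
    (V : ℕ → ℝ)
    (hV : ∀ k : ℕ, V k = (∑ i, ⟪(y k - ystar) i, Ω (y k - ystar) i⟫)
        + (1/ρ) * ∑ i, ‖v k i - vstar i‖^2) :
    ∀ k : ℕ,
      0 ≤ ∑ i, ⟪xstar i - x (k+1) i, y (k+1) i - ystar i⟫ ∧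
      ∑ i, ⟪xstar i - x (k+1) i, y (k+1) i - ystar i⟫ ≤
        (1/2) * (V k - V (k+1) - (∑ i, ⟪(y (k+1) - y k) i, Ω (y (k+1) - y k) i⟫)
          - (1/ρ) * ∑ i, ‖v (k+1) i - v k i‖^2) := by
  intro k
  subst hystar
  obtain rfl : W = blockMulVec L := by ext1 u; ext1 i; rw [hW, blockMulVec_apply]
  obtain rfl : S = blockMulVec M := by ext1 u; ext1 i; rw [hS, blockMulVec_apply]
  set ystar : Fin n → EuclideanSpace ℝ (Fin p) := fun _ => δstar
  let T : (Fin n → EuclideanSpace ℝ (Fin p)) →ₗ[ℝ] (Fin n → EuclideanSpace ℝ (Fin p)) :=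
    η • LinearMap.id - ρ • blockMulVec L
  obtain rfl : Ω = T := by ext1 u; rw [hΩdef]; rfl
  have hT : ∀ u w, tupleInner u (T w) = tupleInner (T u) w := by
    intro u w
    simp [T, tupleInner_blockMulVec hLsymm]
  have hMystar : blockMulVec M ystar = 0 :=
    blockMulVec_eq_zero_of_mul_self hMsymm (by rw [hMM]; exact blockMulVec_const hLrow δstar)
  constructor
  · have hopt : ∀ i, f i (x (k+1) i) ≤
        f i (xstar i) + ⟪y (k+1) i, xstar i - x (k+1) i⟫ := by
      intro i
      obtain ⟨a, hshift⟩ : ∃ a, ∀ ζ, y k i + η⁻¹ • (ζ - d i + blockMulVec M (v k) i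
          - ρ • blockMulVec L (y k) i) = η⁻¹ • ζ + a :=
        ⟨y k i + η⁻¹ • (blockMulVec M (v k) i - d i - ρ • blockMulVec L (y k) i),
          fun ζ => by module⟩
      refine ((hfconv i).subset (Set.subset_univ _) (hXconv i)).le_add_inner_of_isMinOn_prox hη
        (a := a) (hxX k i) (hxstarX i) ?_ (isMinOn_iff.2 fun ξ hξ => ?_)
      · rw [← hshift, hy k]; rfl
      · simpa only [hshift] using hstep k i ξ hξ
    have hsum := Finset.sum_le_sum fun i (_ : i ∈ Finset.univ) => hopt i
    have hsad := hsaddle (x (k+1)) (hxX k)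
    rw [Finset.sum_add_distrib] at hsum
    have hsplit : ∑ i, ⟪xstar i - x (k+1) i, y (k+1) i - ystar i⟫ =
        ∑ i, ⟪y (k+1) i, xstar i - x (k+1) i⟫ + ∑ i, ⟪ystar i, x (k+1) i - xstar i⟫ := by
      rw [← Finset.sum_add_distrib]
      refine Finset.sum_congr rfl fun i _ => ?_
      rw [← neg_sub (xstar i) (x (k+1) i), inner_neg_right, ← sub_eq_add_neg, ← inner_sub_left,
        real_inner_comm]
    linarith
  · have hres : xstar - x (k+1) = blockMulVec M (v (k+1) - vstar) + T (y k - y (k+1)) := by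
      have hx : x (k+1) = d + η • (y (k+1) - y k) - blockMulVec M (v k)
          + ρ • blockMulVec L (y k) := by
        rw [hy k, add_sub_cancel_left, smul_inv_smul₀ hη.ne']
        abel
      have hxs : xstar = d - blockMulVec M vstar := by rw [hvstar]; abel
      have hMv : blockMulVec M (v k)
          = blockMulVec M (v (k+1)) + ρ • blockMulVec L (y (k+1)) := by
        rw [hv k, map_sub, map_smul, ← blockMulVec_mul, hMM]; abel
      rw [hx, hxs, hMv]
      simp only [T, map_sub, LinearMap.sub_apply, LinearMap.smul_apply, LinearMap.id_apply]
      module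
    have hMy : blockMulVec M (y (k+1) - ystar) = ρ⁻¹ • (v k - v (k+1)) := by
      rw [map_sub, hMystar, hv k, sub_zero, sub_sub_cancel, inv_smul_smul₀ hρ.ne']
    have hdual := tupleInner_three_point (T := LinearMap.id) (fun _ _ => rfl)
      (v k - vstar) (v (k+1) - vstar)
    have hprim := tupleInner_three_point hT (y k - ystar) (y (k+1) - ystar)
    simp only [LinearMap.id_apply, sub_sub_sub_cancel_right, tupleInner_self,
      Pi.sub_apply] at hdual hprim
    have hinner : ∑ i, ⟪xstar i - x (k+1) i, y (k+1) i - ystar i⟫ =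
        ρ⁻¹ * tupleInner (v (k+1) - vstar) (v k - v (k+1))
          + tupleInner (y (k+1) - ystar) (T (y k - y (k+1))) := by
      have : ∑ i, ⟪xstar i - x (k+1) i, y (k+1) i - ystar i⟫ =
          tupleInner (xstar - x (k+1)) (y (k+1) - ystar) := by
        simp only [tupleInner_apply, Pi.sub_apply]
      rw [this, hres, map_add, LinearMap.add_apply, ← tupleInner_blockMulVec hMsymm, hMy,
        map_smul, smul_eq_mul, tupleInner_comm (T _)]
    rw [hinner, hV, hV]
    simp only [← tupleInner_apply]
    refine le_of_eq ?_
    rw [one_div ρ]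
    linear_combination (1/2) * hprim + (ρ⁻¹/2) * hdual
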